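/- arXiv:1803.00440 — 2 statements merged into one kernel-verified Lean document; each statement's English description precedes it below -/
import Mathlib

section
/- Let d and m be positive integers, let K̄ be the closed unit ball of ℝ^d, and let q : ℝ^d → Herm_m(ℂ) be continuous. Set γ = ∫_{K̄} #{eigenvalues λ of q(x), counted with multiplicity, with λ ≤ 0} dx. Then for every ε > 0 there exist finitely many open balls B₁, …, B_N ⊆ ℝ^d, vectors v₁, …, v_N ∈ ℂ^m, and positive real constants C₁, …, C_N and c₀ such that for every x ∈ K̄ the Hermitian matrix q(x) + Σ_{j=1}^N C_j·1_{B_j}(x)·v_j v_j* − 3c₀·Id is positive semidefinite, and Σ_{j=1}^N vol(B_j) ≤ γ + ε. -/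
open MeasureTheory
open scoped ComplexOrder

namespace S8
open Matrix Filter Topology

/-- The (real) quadratic form of a matrix. -/
noncomputable def Qf {m : ℕ} (A : Matrix (Fin m) (Fin m) ℂ) (w : Fin m → ℂ) : ℝ :=
  (star w ⬝ᵥ A *ᵥ w).re

/-- Squared modulus of the pairing of `v` and `w`. -/
noncomputable def Pf {m : ℕ} (v w : Fin m → ℂ) : ℝ := Complex.normSq (star v ⬝ᵥ w)

/-- eigenvectors -/
noncomputable def ev {m : ℕ} {A : Matrix (Fin m) (Fin m) ℂ} (h : A.IsHermitian) (i : Fin m) :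
    Fin m → ℂ := ⇑(h.eigenvectorBasis i)

/-- indices of nonpositive eigenvalues -/
noncomputable def Fs {m : ℕ} {A : Matrix (Fin m) (Fin m) ℂ} (h : A.IsHermitian) : Finset (Fin m) :=
  Finset.univ.filter fun i => h.eigenvalues i ≤ 0

lemma Pf_nonneg {m : ℕ} (v w : Fin m → ℂ) : 0 ≤ Pf v w := Complex.normSq_nonneg _

lemma Qf_add {m : ℕ} (A B : Matrix (Fin m) (Fin m) ℂ) (w : Fin m → ℂ) :
    Qf (A + B) w = Qf A w + Qf B w := by
  simp [Qf, Matrix.add_mulVec]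

lemma Qf_sub {m : ℕ} (A B : Matrix (Fin m) (Fin m) ℂ) (w : Fin m → ℂ) :
    Qf (A - B) w = Qf A w - Qf B w := by
  simp [Qf, Matrix.sub_mulVec]

lemma Qf_smul {m : ℕ} (c : ℝ) (A : Matrix (Fin m) (Fin m) ℂ) (w : Fin m → ℂ) :
    Qf (c • A) w = c * Qf A w := by
  simp [Qf, Matrix.smul_mulVec]

lemma Qf_sum {m : ℕ} {ι : Type*} (s : Finset ι) (A : ι → Matrix (Fin m) (Fin m) ℂ)
    (w : Fin m → ℂ) : Qf (∑ i ∈ s, A i) w = ∑ i ∈ s, Qf (A i) w := by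
  simp [Qf, Matrix.sum_mulVec, dotProduct_sum]

lemma Qf_vec {m : ℕ} (v w : Fin m → ℂ) : Qf (vecMulVec v (star v)) w = Pf v w := by
  have h : star w ⬝ᵥ v = star (star v ⬝ᵥ w) := by rw [star_dotProduct]
  rw [Qf, Pf, vecMulVec_mulVec, dotProduct_smul, h]
  simp [Complex.normSq_apply]

lemma Qf_homog {m : ℕ} (A : Matrix (Fin m) (Fin m) ℂ) (t : ℝ) (w : Fin m → ℂ) :
    Qf A (t • w) = t ^ 2 * Qf A w := by
  simp [Qf, Matrix.mulVec_smul, star_smul, smul_dotProduct]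
  ring

lemma ev_apply {m : ℕ} {A : Matrix (Fin m) (Fin m) ℂ} (h : A.IsHermitian) (w : Fin m → ℂ)
    (i : Fin m) :
    ((star (h.eigenvectorUnitary : Matrix (Fin m) (Fin m) ℂ)) *ᵥ w) i = star (ev h i) ⬝ᵥ w := by
  rfl

lemma re_dot {m : ℕ} (a b : Fin m → ℂ) :
    (star a ⬝ᵥ b).re = ∑ i, (star (a i) * b i).re := by
  simp [dotProduct]

lemma Qf_spec {m : ℕ} {A : Matrix (Fin m) (Fin m) ℂ} (h : A.IsHermitian) (w : Fin m → ℂ) :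
    Qf A w = ∑ i, h.eigenvalues i * Pf (ev h i) w := by
  have hs := h.spectral_theorem
  rw [Unitary.conjStarAlgAut_apply] at hs
  rw [Qf]
  conv_lhs => rw [hs]
  rw [← mulVec_mulVec, ← mulVec_mulVec, dotProduct_mulVec, ← star_star (star w ᵥ* _),
    star_vecMul, star_star, ← star_eq_conjTranspose]
  rw [re_dot]
  refine Finset.sum_congr rfl fun i _ => ?_
  simp only [mulVec_diagonal, ev_apply, Pf, Function.comp]
  generalize star (ev h i) ⬝ᵥ w = z
  simp [Complex.normSq_apply]
  ring

lemma Qf_one {m : ℕ} {A : Matrix (Fin m) (Fin m) ℂ} (h : A.IsHermitian) (w : Fin m → ℂ) :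
    Qf 1 w = ∑ i, Pf (ev h i) w := by
  have hs : (1 : Matrix (Fin m) (Fin m) ℂ) =
    (h.eigenvectorUnitary : Matrix (Fin m) (Fin m) ℂ) * star
      (h.eigenvectorUnitary : Matrix (Fin m) (Fin m) ℂ) := by simp
  rw [Qf, hs, ← mulVec_mulVec, dotProduct_mulVec, ← star_star (star w ᵥ* _),
    star_vecMul, star_star, ← star_eq_conjTranspose]
  rw [re_dot]
  refine Finset.sum_congr rfl fun i _ => ?_
  simp only [ev_apply, Pf]
  generalize star (ev h i) ⬝ᵥ w = z
  simp [Complex.normSq_apply]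

lemma Qf_one_pos {m : ℕ} {w : Fin m → ℂ} (hw : w ≠ 0) : 0 < Qf 1 w := by
  have : 0 < star w ⬝ᵥ w := dotProduct_star_self_pos_iff.2 hw
  simp only [Qf, one_mulVec]
  exact (Complex.pos_iff.1 this).1

lemma posSemidef_of_Qf {m : ℕ} {A : Matrix (Fin m) (Fin m) ℂ} (h : A.IsHermitian)
    (hQ : ∀ w, 0 ≤ Qf A w) : A.PosSemidef := by
  refine .of_dotProduct_mulVec_nonneg h fun w => ?_
  rw [Complex.nonneg_iff]
  refine ⟨hQ w, ?_⟩
  have := h.im_star_dotProduct_mulVec_self w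
  simpa using this.symm

lemma local_pos {m : ℕ} {X : Type*} [TopologicalSpace X] (q : X → Matrix (Fin m) (Fin m) ℂ)
    (hherm : ∀ x, (q x).IsHermitian) (hcont : Continuous q) (x : X) :
    ∃ C c : ℝ, 0 < C ∧ 0 < c ∧ ∀ᶠ y in 𝓝 x, ∀ w,
      c * Qf 1 w ≤ Qf (q y) w + C * ∑ i ∈ Fs (hherm x), Pf (ev (hherm x) i) w := by
  set h := hherm x
  obtain ⟨c, hc, hc0⟩ : ∃ c : ℝ, (∀ i, 0 < h.eigenvalues i → c < h.eigenvalues i) ∧ 0 < c := by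
    have h1 : ∀ᶠ c : ℝ in 𝓝[>] 0, ∀ i, 0 < h.eigenvalues i → c < h.eigenvalues i := by
      rw [eventually_all]
      intro i
      by_cases hi : 0 < h.eigenvalues i
      · filter_upwards [Ioo_mem_nhdsGT hi] with c hc _ using hc.2
      · exact Eventually.of_forall fun _ h' => absurd h' hi
    exact (h1.and self_mem_nhdsWithin).exists
  set C : ℝ := 1 + c + ∑ i, |h.eigenvalues i|
  have hC : ∀ i, c < h.eigenvalues i + C := by
    intro i
    have := Finset.single_le_sum (f := fun i => |h.eigenvalues i|) (fun i _ => abs_nonneg _)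
      (Finset.mem_univ i)
    have h2 := neg_abs_le (h.eigenvalues i)
    simp only [C] at *
    linarith
  have hC0 : 0 < C := by positivity
  refine ⟨C, c, hC0, hc0, ?_⟩
  set M : X → Matrix (Fin m) (Fin m) ℂ := fun y => q y +
    C • ∑ i ∈ Fs h, vecMulVec (ev h i) (star (ev h i)) - c • 1
  have hM : ∀ y w, Qf (M y) w = Qf (q y) w + C * ∑ i ∈ Fs h, Pf (ev h i) w - c * Qf 1 w := by
    intro y w
    simp only [M, Qf_add, Qf_sub, Qf_smul, Qf_sum, Qf_vec]
  have hpos : ∀ w, w ≠ 0 → 0 < Qf (M x) w := by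
    intro w hw
    have h1 := Qf_one_pos hw
    rw [hM, Qf_spec h, Qf_one h, Fs, Finset.sum_filter, Finset.mul_sum, Finset.mul_sum,
      ← Finset.sum_add_distrib, ← Finset.sum_sub_distrib]
    rw [Qf_one h] at h1
    obtain ⟨i, -, hi⟩ := Finset.exists_lt_of_sum_lt (s := Finset.univ) (f := fun _ : Fin m => (0:ℝ))
      (by simpa using h1)
    have key : ∀ j, ∃ a > 0, h.eigenvalues j * Pf (ev h j) w +
        C * (if h.eigenvalues j ≤ 0 then Pf (ev h j) w else 0) - c * Pf (ev h j) w
        = a * Pf (ev h j) w := by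
      intro j
      split_ifs with hj
      · exact ⟨h.eigenvalues j + C - c, by linarith [hC j], by ring⟩
      · exact ⟨h.eigenvalues j - c, by linarith [hc j (not_le.1 hj)], by ring⟩
    refine Finset.sum_pos' (fun j _ => ?_) ⟨i, Finset.mem_univ i, ?_⟩
    · obtain ⟨a, ha, e⟩ := key j
      rw [e]; exact mul_nonneg ha.le (Pf_nonneg _ _)
    · obtain ⟨a, ha, e⟩ := key i
      rw [e]; exact mul_pos ha hi
  have hMc : Continuous M := by fun_prop
  have hcontQ : Continuous fun z : X × (Fin m → ℂ) => Qf (M z.1) z.2 := by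
    unfold Qf
    have : Continuous fun z : X × (Fin m → ℂ) => M z.1 := hMc.comp continuous_fst
    exact Complex.continuous_re.comp
      ((continuous_star.comp continuous_snd).dotProduct (this.matrix_mulVec continuous_snd))
  have hev : ∀ᶠ y in 𝓝 x, ∀ w ∈ Metric.sphere (0 : Fin m → ℂ) 1, 0 < Qf (M y) w := by
    refine (isCompact_sphere _ _).eventually_forall_of_forall_eventually fun w hw => ?_
    refine hcontQ.continuousAt.eventually (lt_mem_nhds (hpos w ?_))
    rintro rfl
    simp at hw
  filter_upwards [hev] with y hy w
  have : 0 ≤ Qf (M y) w := by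
    by_cases hw : w = 0
    · simp [hw, Qf]
    · have hn : ‖w‖ ≠ 0 := norm_ne_zero_iff.2 hw
      have e : w = ‖w‖ • (‖w‖⁻¹ • w) := by rw [smul_smul, mul_inv_cancel₀ hn, one_smul]
      rw [e, Qf_homog]
      have := hy (‖w‖⁻¹ • w) (by simp [norm_smul, hn])
      positivity
  rw [hM] at this
  linarith

lemma card_le {m : ℕ} {A B : Matrix (Fin m) (Fin m) ℂ} (hA : A.IsHermitian) (hB : B.IsHermitian)
    {C c : ℝ} (hc : 0 < c)
    (h : ∀ w, c * Qf 1 w ≤ Qf B w + C * ∑ i ∈ Fs hA, Pf (ev hA i) w) :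
    (Fs hB).card ≤ (Fs hA).card := by
  by_contra! hlt
  let f : (Fin m → ℂ) →ₗ[ℂ] (((Fs hB)ᶜ : Finset (Fin m)) ⊕ Fs hA → ℂ) :=
    LinearMap.pi fun i => dotProductBilin ℂ ℂ (star (Sum.elim (fun j => ev hB j.1) (fun j => ev hA j.1) i))
  have hk : LinearMap.ker f ≠ ⊥ := by
    apply LinearMap.ker_ne_bot_of_finrank_lt
    have := Finset.card_compl (Fs hB)
    have h2 := Finset.card_le_univ (Fs hB)
    simp at *
    omega
  obtain ⟨w, hw, hw0⟩ := (Submodule.ne_bot_iff _).1 hk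
  have hw' : ∀ i, f w i = 0 := fun i => congrFun hw i
  have h1 : ∀ i ∈ Fs hA, Pf (ev hA i) w = 0 := fun i hi => by
    have := hw' (.inr ⟨i, hi⟩)
    simp [f] at this
    simp [Pf, this]
  have h2 : ∀ i, i ∉ Fs hB → Pf (ev hB i) w = 0 := fun i hi => by
    have := hw' (.inl ⟨i, Finset.mem_compl.2 hi⟩)
    simp [f] at this
    simp [Pf, this]
  have h3 := h w
  rw [Finset.sum_eq_zero h1] at h3
  have h4 : Qf B w ≤ 0 := by
    rw [Qf_spec hB]
    refine Finset.sum_nonpos fun i _ => ?_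
    by_cases hi : i ∈ Fs hB
    · exact mul_nonpos_of_nonpos_of_nonneg (Finset.mem_filter.1 hi).2 (Pf_nonneg _ _)
    · simp [h2 i hi]
  have := mul_pos hc (Qf_one_pos hw0)
  linarith

lemma covering {d : ℕ} (hd : 0 < d) (T : Set (EuclideanSpace ℝ (Fin d)))
    (hT : volume T ≠ ⊤) (R : EuclideanSpace ℝ (Fin d) → ℝ)
    (hR : ∀ x, 0 < R x) {ε : ℝ} (hε : 0 < ε) :
    ∃ (t : Set (EuclideanSpace ℝ (Fin d))) (r : EuclideanSpace ℝ (Fin d) → ℝ), t ⊆ T ∧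
      (∀ x ∈ t, r x < R x) ∧ (T ⊆ ⋃ x ∈ t, Metric.ball x (r x)) ∧
      ∀ s : Finset (EuclideanSpace ℝ (Fin d)), (s : Set _) ⊆ t →
        ∑ x ∈ s, (volume (Metric.ball x (r x))).toReal ≤ (volume T).toReal + ε := by
  have : Nonempty (Fin d) := ⟨⟨0, hd⟩⟩
  obtain ⟨t, r, -, htT, hr, hcov, hsum⟩ := Besicovitch.exists_closedBall_covering_tsum_measure_le
    (volume : Measure (EuclideanSpace ℝ (Fin d))) (ε := ENNReal.ofReal (ε / 2)) (by simpa using hε)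
    (fun x => Set.Ioo 0 (R x / 2)) T (fun x _ δ hδ => by
      rw [Set.Ioo_inter_Ioo, Set.nonempty_Ioo]
      simp [hδ, hR x])
  obtain ⟨c, hc, hc1, hc2⟩ : ∃ c : ℝ, c ^ d * ((volume T).toReal + ε / 2) < (volume T).toReal + ε ∧
      1 < c ∧ c < 2 := by
    have h1 : ∀ᶠ c : ℝ in 𝓝[>] 1,
        c ^ d * ((volume T).toReal + ε / 2) < (volume T).toReal + ε := by
      apply Filter.Eventually.filter_mono nhdsWithin_le_nhds
      have : Continuous fun c : ℝ => c ^ d * ((volume T).toReal + ε / 2) := by fun_prop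
      refine this.continuousAt.eventually (gt_mem_nhds ?_)
      simp [hε]
    obtain ⟨c, h, h'⟩ := (h1.and (Ioo_mem_nhdsGT (show (1:ℝ) < 2 by norm_num))).exists
    exact ⟨c, h, h'.1, h'.2⟩
  refine ⟨t, fun x => c * r x, htT, fun x hx => ?_, hcov.trans ?_, fun s hs => ?_⟩
  · have := hr x hx
    nlinarith [this.1, this.2]
  · refine Set.iUnion₂_mono fun x hx => Metric.closedBall_subset_ball ?_
    nlinarith [(hr x hx).1]
  · have h1 : ∀ x ∈ s, (volume (Metric.ball x (c * r x))).toReal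
        = c ^ d * (volume (Metric.closedBall x (r x))).toReal := by
      intro x _
      rw [Measure.addHaar_ball_mul_of_pos _ _ (by linarith), ENNReal.toReal_mul,
        Measure.addHaar_closedBall_eq_addHaar_ball, Measure.addHaar_ball_center volume x (r x),
        ENNReal.toReal_ofReal (by positivity)]
      simp
    rw [Finset.sum_congr rfl h1, ← Finset.mul_sum, ← ENNReal.toReal_sum
      (fun x _ => measure_closedBall_lt_top.ne)]
    have h2 : ∑ x ∈ s, volume (Metric.closedBall x (r x)) ≤ volume T + ENNReal.ofReal (ε / 2) := by
      refine le_trans ?_ hsum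
      rw [tsum_subtype t fun x => volume (Metric.closedBall x (r x))]
      refine le_trans (Finset.sum_le_sum fun x hx => ?_) (ENNReal.sum_le_tsum s)
      rw [Set.indicator_of_mem (hs hx)]
    have h3 := ENNReal.toReal_mono (by simp [hT]) h2
    rw [ENNReal.toReal_add hT (by simp), ENNReal.toReal_ofReal (by positivity)] at h3
    calc _ ≤ c ^ d * ((volume T).toReal + ε / 2) := by gcongr
      _ ≤ _ := hc.le

lemma integral_eq {X : Type*} [MeasurableSpace X] (μ : Measure X) (K : Set X) (hK : μ K ≠ ⊤)
    (hKm : MeasurableSet K) (n : X → ℕ) (hn : Measurable n) (m : ℕ) (hm : ∀ x, n x ≤ m) :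
    ∫ x in K, (n x : ℝ) ∂μ =
      ∑ k ∈ Finset.range (m + 1), (k : ℝ) * (μ (K ∩ n ⁻¹' {k})).toReal := by
  have h1 : ∀ x, (n x : ℝ) =
      ∑ k ∈ Finset.range (m + 1), (n ⁻¹' {k}).indicator (fun _ => (k : ℝ)) x := by
    intro x
    rw [Finset.sum_eq_single (n x)]
    · simp
    · intro k _ hk
      rw [Set.indicator_of_notMem]
      simpa using hk.symm
    · intro h
      have := hm x
      simp at h
      omega
  have hms : ∀ k, MeasurableSet (n ⁻¹' {k}) := fun k => hn (measurableSet_singleton k)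
  simp_rw [h1]
  have : IsFiniteMeasure (μ.restrict K) := ⟨by simpa using hK.lt_top⟩
  rw [integral_finsetSum]
  · refine Finset.sum_congr rfl fun k _ => ?_
    rw [integral_indicator_const _ (hms k), Measure.real, Measure.restrict_apply (hms k),
      Set.inter_comm, smul_eq_mul, mul_comm]
  · intro k _
    exact (integrable_const _).indicator (hms k)

lemma main {d m : ℕ} (hd : 0 < d)
    (q : EuclideanSpace ℝ (Fin d) → Matrix (Fin m) (Fin m) ℂ)
    (hherm : ∀ x, (q x).IsHermitian) (hcont : Continuous q) (ε : ℝ) (hε : 0 < ε) :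
    ∃ (s : Finset (EuclideanSpace ℝ (Fin d))) (ρ : EuclideanSpace ℝ (Fin d) → ℝ)
      (C : EuclideanSpace ℝ (Fin d) → ℝ) (c₀ : ℝ), (∀ x, 0 < C x) ∧ 0 < c₀ ∧
      (∀ y ∈ Metric.closedBall (0 : EuclideanSpace ℝ (Fin d)) 1, ∃ x ∈ s, y ∈ Metric.ball x (ρ x) ∧
        ∀ w, 3 * c₀ * Qf 1 w ≤ Qf (q y) w + C x * ∑ i ∈ Fs (hherm x), Pf (ev (hherm x) i) w) ∧
      ∑ x ∈ s, ((Fs (hherm x)).card : ℝ) * (volume (Metric.ball x (ρ x))).toReal ≤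
          (∫ x in Metric.closedBall (0 : EuclideanSpace ℝ (Fin d)) 1,
            ((Fs (hherm x)).card : ℝ)) + ε := by
  choose C c hC hc hev using local_pos q hherm hcont
  set n : EuclideanSpace ℝ (Fin d) → ℕ := fun x => (Fs (hherm x)).card
  have hnm : ∀ x, n x ≤ m := fun x => by simpa using Finset.card_le_univ (Fs (hherm x))
  have hn : Measurable n := by
    apply UpperSemicontinuous.measurable
    intro x k hk
    filter_upwards [hev x] with y hy
    exact (card_le (hherm x) (hherm y) (hc x) hy).trans_lt hk
  have hR : ∀ x, ∃ R > 0, ∀ y ∈ Metric.ball x R, ∀ w, c x * Qf 1 w ≤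
      Qf (q y) w + C x * ∑ i ∈ Fs (hherm x), Pf (ev (hherm x) i) w := fun x =>
    Metric.eventually_nhds_iff_ball.1 (hev x)
  choose R hR0 hR using hR
  set K := Metric.closedBall (0 : EuclideanSpace ℝ (Fin d)) 1
  have hKfin : volume K ≠ ⊤ := measure_closedBall_lt_top.ne
  have hε' : 0 < ε / ((m + 1) * (m + 1)) := by positivity
  have hcov := fun k : ℕ => covering hd (K ∩ n ⁻¹' {k})
    (measure_ne_top_of_subset Set.inter_subset_left hKfin) R hR0 hε'
  choose t r htT hr ht hs using hcov
  have hnt : ∀ k, ∀ x ∈ t k, n x = k := fun k x hx => (htT k hx).2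
  obtain ⟨b, hb, hbf, hbK⟩ := (isCompact_closedBall (0 : EuclideanSpace ℝ (Fin d)) 1).elim_finite_subcover_image
    (b := {x | x ∈ t (n x)}) (c := fun x => Metric.ball x (r (n x) x))
    (fun _ _ => Metric.isOpen_ball) (by
      intro y hy
      have := ht (n y) ⟨hy, rfl⟩
      simp only [Set.mem_iUnion] at this ⊢
      obtain ⟨x, hx, hyx⟩ := this
      have e := hnt _ x hx
      exact ⟨x, by simpa [e] using hx, by simpa [e] using hyx⟩)
  lift b to Finset (EuclideanSpace ℝ (Fin d)) using hbf
  obtain ⟨c₀, hc₀, hc₀'⟩ : ∃ c₀ : ℝ, (∀ x ∈ b, 3 * c₀ < c x) ∧ 0 < c₀ := by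
    have h1 : ∀ᶠ c₀ : ℝ in 𝓝[>] 0, ∀ x ∈ b, 3 * c₀ < c x := by
      rw [Filter.eventually_all_finset]
      intro x _
      filter_upwards [Ioo_mem_nhdsGT (show 0 < c x / 3 by linarith [hc x])] with a ha
      linarith [ha.2]
    exact (h1.and self_mem_nhdsWithin).exists
  refine ⟨b, fun x => r (n x) x, C, c₀, hC, hc₀', fun y hy => ?_, ?_⟩
  · have := hbK hy
    simp only [Set.mem_iUnion] at this
    obtain ⟨x, hx, hyx⟩ := this
    refine ⟨x, hx, hyx, fun w => le_trans ?_ (hR x y ?_ w)⟩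
    · have : 0 ≤ Qf 1 w := by
        by_cases hw : w = 0
        · simp [hw, Qf]
        · exact (Qf_one_pos hw).le
      exact mul_le_mul_of_nonneg_right (hc₀ x hx).le this
    · exact Metric.ball_subset_ball (hr _ x (hb hx)).le hyx
  · rw [integral_eq volume K hKfin measurableSet_closedBall n hn m hnm]
    rw [← Finset.sum_fiberwise_of_maps_to (s := b) (t := Finset.range (m + 1)) (g := n)
      (fun x _ => Finset.mem_range.2 (Nat.lt_succ_of_le (hnm x)))]
    calc _ ≤ ∑ k ∈ Finset.range (m + 1), ((k : ℝ) * (volume (K ∩ n ⁻¹' {k})).toReal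
          + ε / (m + 1)) := by
          refine Finset.sum_le_sum fun k hk => ?_
          have h1 := hs k (b.filter fun x => n x = k) (by
            intro x hx
            simp only [Finset.coe_filter, Set.mem_ofPred_eq] at hx
            have := hb hx.1
            simpa [hx.2] using this)
          have hk' : (k : ℝ) ≤ m + 1 := by
            exact_mod_cast (Finset.mem_range.1 hk).le
          calc _ = (k : ℝ) * ∑ x ∈ b.filter (fun x => n x = k),
                (volume (Metric.ball x (r k x))).toReal := by
                rw [Finset.mul_sum]
                refine Finset.sum_congr rfl fun x hx => ?_
                have e : n x = k := (Finset.mem_filter.1 hx).2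
                have e' : (Fs (hherm x)).card = k := e
                beta_reduce
                rw [e, e']
            _ ≤ (k : ℝ) * ((volume (K ∩ n ⁻¹' {k})).toReal + ε / ((m + 1) * (m + 1))) := by gcongr
            _ = (k : ℝ) * (volume (K ∩ n ⁻¹' {k})).toReal + k * (ε / ((m + 1) * (m + 1))) := by ring
            _ ≤ (k : ℝ) * (volume (K ∩ n ⁻¹' {k})).toReal
                + (m + 1) * (ε / ((m + 1) * (m + 1))) := by gcongr
            _ = _ := by field_simp
      _ = _ := by
          rw [Finset.sum_add_distrib]
          congr 1
          simp
          field_simp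

end S8

/-- Covering-and-rank-one-perturbation lemma: for a continuous Hermitian
matrix valued function `q` on `ℝ^d` and `γ = ∫_{K̄} #{eigenvalues ≤ 0 of q(x)} dx` over the
closed unit ball `K̄`, for every `ε > 0` there are finitely many open balls `B_j`, vectors
`v_j`, and positive constants `C_j, c₀` such that
`q(x) + ∑ⱼ Cⱼ 1_{Bⱼ}(x) vⱼvⱼ* − 3c₀·Id ⪰ 0` on `K̄` and `∑ⱼ vol(Bⱼ) ≤ γ + ε`. -/
theorem statement8 (d m : ℕ) (hd : 0 < d) (hm : 0 < m)
    (q : EuclideanSpace ℝ (Fin d) → Matrix (Fin m) (Fin m) ℂ)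
    (hherm : ∀ x, (q x).IsHermitian)
    (hcont : Continuous q) :
    ∀ ε : ℝ, 0 < ε →
      ∃ (N : ℕ) (y : Fin N → EuclideanSpace ℝ (Fin d)) (ρ : Fin N → ℝ)
        (v : Fin N → (Fin m → ℂ)) (C : Fin N → ℝ) (c₀ : ℝ),
        (∀ j, 0 < C j) ∧ 0 < c₀ ∧
        (∀ x ∈ Metric.closedBall (0 : EuclideanSpace ℝ (Fin d)) 1,
          (q x
            + ∑ j, Set.indicator (Metric.ball (y j) (ρ j)) (fun _ => C j) x •
                Matrix.vecMulVec (v j) (star (v j))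
            - (3 * c₀ : ℝ) • (1 : Matrix (Fin m) (Fin m) ℂ)).PosSemidef) ∧
        ∑ j, (volume (Metric.ball (y j) (ρ j))).toReal ≤
          (∫ x in Metric.closedBall (0 : EuclideanSpace ℝ (Fin d)) 1,
            ((Finset.univ.filter fun i => (hherm x).eigenvalues i ≤ 0).card : ℝ)) + ε := by
  intro ε hε
  obtain ⟨s, ρ, C, c₀, hC, hc₀, hpos, hsum⟩ := S8.main hd q hherm hcont ε hε
  let ι := Σ x : s, S8.Fs (hherm x.1)
  let e : Fin (Fintype.card ι) ≃ ι := (Fintype.equivFin ι).symm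
  refine ⟨Fintype.card ι, fun j => (e j).1.1, fun j => ρ (e j).1.1,
    fun j => S8.ev (hherm (e j).1.1) (e j).2.1, fun j => C (e j).1.1, c₀, fun j => hC _, hc₀,
    fun y hy => ?_, ?_⟩
  · rw [e.sum_comp (fun i : ι => Set.indicator (Metric.ball i.1.1 (ρ i.1.1))
      (fun _ => C i.1.1) y • Matrix.vecMulVec (S8.ev (hherm i.1.1) i.2.1)
        (star (S8.ev (hherm i.1.1) i.2.1)))]
    have hnn : ∀ x, 0 ≤ Set.indicator (Metric.ball x (ρ x)) (fun _ => C x) y := fun x =>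
      Set.indicator_nonneg (fun _ _ => (hC x).le) _
    apply S8.posSemidef_of_Qf
    · refine ((hherm y).add ?_).sub ?_
      · refine (Matrix.posSemidef_sum _ fun i _ => ?_).isHermitian
        exact (Matrix.posSemidef_vecMulVec_self_star _).smul (hnn _)
      · exact (Matrix.PosSemidef.one.smul (by positivity : (0 : ℝ) ≤ 3 * c₀)).isHermitian
    · intro w
      obtain ⟨x, hx, hyx, hw⟩ := hpos y hy
      simp only [S8.Qf_sub, S8.Qf_add, S8.Qf_smul, S8.Qf_sum, S8.Qf_vec]
      rw [Fintype.sum_sigma]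
      have h1 := Finset.single_le_sum (f := fun x : s => ∑ i : S8.Fs (hherm x.1),
        Set.indicator (Metric.ball x.1 (ρ x.1)) (fun _ => C x.1) y *
          S8.Pf (S8.ev (hherm x.1) i.1) w)
        (fun x _ => Finset.sum_nonneg fun i _ => mul_nonneg (hnn _) (S8.Pf_nonneg _ _))
        (Finset.mem_univ (⟨x, hx⟩ : s))
      simp only [Set.indicator_of_mem hyx] at h1
      rw [← Finset.mul_sum,
        Finset.sum_coe_sort (S8.Fs (hherm x)) (fun i => S8.Pf (S8.ev (hherm x) i) w)] at h1
      have h2 := hw w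
      linarith
  · refine le_trans (le_of_eq ?_) hsum
    rw [e.sum_comp (fun i : ι => (volume (Metric.ball i.1.1 (ρ i.1.1))).toReal),
      Fintype.sum_sigma, ← Finset.sum_coe_sort s]
    simp
end

section
/- Let N and p be positive integers, let R > 0, let a : ℂ^p → Mat_{N×N}(ℂ) be a linear map, and let A : ℂ^p × B_R(0) → Mat_{N×N}(ℂ) be holomorphic with A(c, 0) = a(c) for all c ∈ ℂ^p. Then for every bounded open set U ⊆ ℂ^p there exist a holomorphic function Q : U × B_R(0) → Mat_{N×N}(ℂ) and a holomorphic function k : U → ℂ such that: (i) z·∂_z Q(c, z) = A(c, z)·Q(c, z) − Q(c, z)·a(c) for all (c, z) ∈ U × B_R(0); (ii) Q(c, 0) = k(c)·Id for all c ∈ U; and (iii) for every c ∈ U such that no two eigenvalues of a(c) differ by a nonzero integer, one has k(c) ≠ 0 and Q(c, z) is invertible for every z ∈ B_R(0). -/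
open Filter Topology Metric

/-- Cauchy estimate for the Fréchet derivative. -/
lemma aux_norm_fderiv_le {E : Type*} [NormedAddCommGroup E] [NormedSpace ℂ E]
    {f : E → ℂ} {x : E} {ρ B : ℝ} (hρ : 0 < ρ) (hf : ∀ y ∈ ball x ρ, DifferentiableAt ℂ f y)
    (hB0 : 0 ≤ B) (hB : ∀ y ∈ ball x ρ, ‖f y‖ ≤ B) : ‖fderiv ℂ f x‖ ≤ B / (ρ / 2) := by
  refine ContinuousLinearMap.opNorm_le_bound _ (by positivity) fun v => ?_
  by_cases hv : v = 0
  · simp [hv]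
  have hv' : 0 < ‖v‖ := norm_pos_iff.2 hv
  set r : ℝ := (ρ / 2) / ‖v‖ with hr
  have hr0 : 0 < r := by positivity
  have hmem : ∀ t ∈ closedBall (0 : ℂ) r, x + t • v ∈ ball x ρ := by
    intro t ht
    rw [mem_ball, dist_eq_norm, add_sub_cancel_left, norm_smul]
    rw [mem_closedBall, dist_zero_right] at ht
    calc ‖t‖ * ‖v‖ ≤ r * ‖v‖ := by gcongr
      _ = ρ / 2 := by rw [hr]; field_simp
      _ < ρ := by linarith
  have hd : ∀ t ∈ closedBall (0 : ℂ) r, DifferentiableAt ℂ (fun t : ℂ => f (x + t • v)) t := by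
    intro t ht
    exact (hf _ (hmem t ht)).comp t (by fun_prop)
  have h1 : DifferentiableOn ℂ (fun t : ℂ => f (x + t • v)) (closedBall 0 r) :=
    fun t ht => (hd t ht).differentiableWithinAt
  have h2 : DiffContOnCl ℂ (fun t : ℂ => f (x + t • v)) (ball 0 r) :=
    h1.diffContOnCl_ball subset_rfl
  have h3 := Complex.norm_deriv_le_of_forall_mem_sphere_norm_le hr0 h2
    (fun z hz => hB _ (hmem z (sphere_subset_closedBall hz)))
  have h4 : HasDerivAt (fun t : ℂ => f (x + t • v)) (fderiv ℂ f x v) 0 := by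
    have h5 : HasDerivAt (fun t : ℂ => x + t • v) v 0 := by
      simpa using ((hasDerivAt_id (0 : ℂ)).smul_const v).const_add x
    have h6 : HasFDerivAt f (fderiv ℂ f x) (x + (0 : ℂ) • v) := by
      simpa using (hf x (mem_ball_self hρ)).hasFDerivAt
    exact h6.comp_hasDerivAt 0 h5
  rw [h4.deriv] at h3
  calc ‖fderiv ℂ f x v‖ ≤ B / r := h3
    _ = B / (ρ / 2) * ‖v‖ := by rw [hr]; field_simp

/-- Locally uniform limits of holomorphic functions on normed spaces are holomorphic. -/
lemma aux_limit {E : Type*} [NormedAddCommGroup E] [NormedSpace ℂ E]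
    {V : Set E} (hV : IsOpen V) {f : ℕ → E → ℂ} {g : E → ℂ}
    (hf : ∀ n, DifferentiableOn ℂ (f n) V)
    (hlim : ∀ x ∈ V, ∃ W ∈ 𝓝 x, TendstoUniformlyOn f g atTop W) :
    DifferentiableOn ℂ g V := by
  intro x hx
  obtain ⟨W, hW, hu⟩ := hlim x hx
  obtain ⟨ρ, hρ, hsub⟩ := Metric.mem_nhds_iff.1 (inter_mem hW (hV.mem_nhds hx))
  have hdiff : ∀ n, ∀ y ∈ ball x ρ, DifferentiableAt ℂ (f n) y := fun n y hy =>
    (hf n).differentiableAt (hV.mem_nhds (hsub hy).2)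
  have hu' : TendstoUniformlyOn f g atTop (ball x ρ) := hu.mono fun y hy => (hsub hy).1
  have hsubball : ∀ y ∈ ball x (ρ/2), ball y (ρ/2) ⊆ ball x ρ := fun y hy =>
    ball_subset_ball' (by rw [mem_ball] at hy; linarith)
  have hC : UniformCauchySeqOn (fun n => fderiv ℂ (f n)) atTop (ball x (ρ/2)) := by
    rw [Metric.uniformCauchySeqOn_iff]
    intro ε hε
    have h1 := Metric.uniformCauchySeqOn_iff.1 hu'.uniformCauchySeqOn (ε / 2 * (ρ/2/2)) (by positivity)
    obtain ⟨n0, hn0⟩ := h1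
    refine ⟨n0, fun m hm n hn y hy => ?_⟩
    have hdm := fun w hw => hdiff m w (hsubball y hy hw)
    have hdn := fun w hw => hdiff n w (hsubball y hy hw)
    have h2 := aux_norm_fderiv_le (f := fun w => f m w - f n w) (x := y) (ρ := ρ/2)
      (B := ε / 2 * (ρ/2/2)) (by positivity) (fun w hw => (hdm w hw).sub (hdn w hw)) (by positivity)
      (fun w hw => by
        have := hn0 m hm n hn w (hsubball y hy hw)
        rw [dist_eq_norm] at this
        exact this.le)
    have hy0 : y ∈ ball y (ρ/2) := mem_ball_self (by positivity)
    rw [dist_eq_norm]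
    have h3 : fderiv ℂ (fun w => f m w - f n w) y = fderiv ℂ (f m) y - fderiv ℂ (f n) y :=
      fderiv_sub (hdm y hy0) (hdn y hy0)
    rw [h3] at h2
    have : ε / 2 * (ρ/2/2) / (ρ/2/2) = ε / 2 := by field_simp
    linarith
  have hlimex : ∀ y ∈ ball x (ρ/2), ∃ L, Tendsto (fun n => fderiv ℂ (f n) y) atTop (𝓝 L) :=
    fun y hy => cauchySeq_tendsto_of_complete (hC.cauchySeq hy)
  choose! g' hg' using hlimex
  have hU := hC.tendstoUniformlyOn_of_tendsto hg'
  have hhalf : ball x (ρ/2) ⊆ ball x ρ := ball_subset_ball (by linarith)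
  exact (hasFDerivAt_of_tendstoUniformlyOn isOpen_ball hU
    (fun n y hy => (hdiff n y (hhalf hy)).hasFDerivAt)
    (fun y hy => hu'.tendsto_at (hhalf hy))
    (mem_ball_self (by positivity))).differentiableAt.differentiableWithinAt

/-- Taylor coefficients in the last variable are holomorphic in the parameters. -/
lemma aux_coeff {E : Type*} [NormedAddCommGroup E] [NormedSpace ℂ E] [ProperSpace E]
    {R : ℝ} (hR : 0 < R) {f : E × ℂ → ℂ}
    (hf : DifferentiableOn ℂ f (Set.univ ×ˢ ball (0 : ℂ) R)) :
    ∃ α : ℕ → E → ℂ, (∀ n, Differentiable ℂ (α n)) ∧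
      (∀ c, ∀ z ∈ ball (0 : ℂ) R, HasSum (fun n => α n c * z ^ n) (f (c, z))) ∧
      (∀ c, α 0 c = f (c, 0)) ∧
      (∀ c0, ∀ r, 0 < r → r < R → ∃ C, 0 ≤ C ∧ ∀ c ∈ ball c0 1, ∀ n, ‖α n c‖ ≤ C / r ^ n) := by
  have hopen : IsOpen ((Set.univ : Set E) ×ˢ ball (0 : ℂ) R) := isOpen_univ.prod isOpen_ball
  have hfc : ∀ c, DifferentiableOn ℂ (fun z => f (c, z)) (ball 0 R) := by
    intro c z hz
    have h1 : DifferentiableAt ℂ f (c, z) :=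
      hf.differentiableAt (hopen.mem_nhds ⟨Set.mem_univ _, hz⟩)
    exact (h1.comp z (f := fun z => (c, z)) (by fun_prop)).differentiableWithinAt
  set α : ℕ → E → ℂ := fun n c => ((n.factorial : ℂ))⁻¹ * iteratedDeriv n (fun z => f (c, z)) 0
    with hα
  have hsum : ∀ c, ∀ z ∈ ball (0 : ℂ) R, HasSum (fun n => α n c * z ^ n) (f (c, z)) := by
    intro c z hz
    have := Complex.hasSum_taylorSeries_on_ball (hfc c) hz
    have he : (fun n => α n c * z ^ n) = fun n : ℕ =>
        ((n.factorial : ℂ))⁻¹ • (z - 0) ^ n • iteratedDeriv n (fun z => f (c, z)) 0 := by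
      funext n
      simp only [hα, smul_eq_mul, sub_zero]; ring
    rw [he]
    exact this
  have hbound : ∀ c0, ∀ r, 0 < r → r < R →
      ∃ C, 0 ≤ C ∧ ∀ c ∈ ball c0 1, ∀ n, ‖α n c‖ ≤ C / r ^ n := by
    intro c0 r hr hrR
    have hK : IsCompact (closedBall c0 1 ×ˢ closedBall (0 : ℂ) r) :=
      (isCompact_closedBall _ _).prod (isCompact_closedBall _ _)
    have hcont : ContinuousOn f (closedBall c0 1 ×ˢ closedBall (0 : ℂ) r) :=
      hf.continuousOn.mono (Set.prod_mono (Set.subset_univ _) (closedBall_subset_ball hrR))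
    obtain ⟨C, hC⟩ := hK.exists_bound_of_continuousOn hcont
    refine ⟨C, (norm_nonneg _).trans (hC (c0, 0) ⟨mem_closedBall_self (by norm_num),
      mem_closedBall_self hr.le⟩), fun c hc n => ?_⟩
    have h1 := Complex.norm_iteratedDeriv_le_of_forall_mem_sphere_norm_le (c := 0) (C := C) n hr
      (((hfc c).mono (closedBall_subset_ball hrR)).diffContOnCl_ball subset_rfl)
      (fun z hz => hC (c, z) ⟨ball_subset_closedBall hc, sphere_subset_closedBall hz⟩)
    simp only [hα, norm_mul, norm_inv, Complex.norm_natCast]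
    have h2 : (0 : ℝ) < n.factorial := by positivity
    calc _ ≤ (n.factorial : ℝ)⁻¹ * (n.factorial * C / r ^ n) := by gcongr
      _ = C / r ^ n := by field_simp
  refine ⟨α, ?_, hsum, fun c => by simp [hα], hbound⟩
  intro n
  induction n using Nat.strong_induction_on with
  | _ m ih =>
  rw [← differentiableOn_univ]
  -- sample points
  obtain ⟨r, hr, hrR⟩ := exists_between hR
  set w : ℕ → ℝ := fun n => r / (n + 2) with hw
  have hw0 : ∀ n, 0 < w n := fun n => by positivity
  have hwr : ∀ n, w n / r ≤ 1 / 2 := fun n => by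
    have : w n / r = 1 / (n + 2) := by simp only [hw]; field_simp
    rw [this]
    apply one_div_le_one_div_of_le <;> norm_num
  have hwR : ∀ n, (w n : ℂ) ∈ ball (0 : ℂ) R := fun n => by
    rw [mem_ball, dist_zero_right, Complex.norm_real, Real.norm_of_nonneg (hw0 n).le]
    have := hwr n
    rw [div_le_iff₀ hr] at this
    linarith
  refine aux_limit isOpen_univ
    (f := fun n c => (f (c, (w n : ℂ)) - ∑ j ∈ Finset.range m, α j c * (w n : ℂ) ^ j) / (w n : ℂ) ^ m)
    ?_ ?_
  · intro n
    simp only [div_eq_mul_inv]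
    refine DifferentiableOn.mul_const (DifferentiableOn.fun_sub ?_ ?_) _
    · exact hf.comp (f := fun c : E => (c, (w n : ℂ))) (by fun_prop)
        (fun c _ => ⟨Set.mem_univ _, hwR n⟩)
    · refine DifferentiableOn.fun_sum fun j hj => ?_
      exact ((ih j (Finset.mem_range.1 hj)).differentiableOn).mul_const _
  · intro c0 _
    obtain ⟨C, hC0, hC⟩ := hbound c0 r hr hrR
    refine ⟨ball c0 1, ball_mem_nhds _ one_pos, ?_⟩
    have key : ∀ n, ∀ c ∈ ball c0 1,
        ‖(f (c, (w n : ℂ)) - ∑ j ∈ Finset.range m, α j c * (w n : ℂ) ^ j) / (w n : ℂ) ^ m - α m c‖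
          ≤ 2 * C / r ^ m * (w n / r) := by
      intro n c hc
      have hwc : (w n : ℂ) ≠ 0 := by exact_mod_cast (hw0 n).ne'
      have h1 := (hasSum_nat_add_iff' (m+1)).2 (hsum c _ (hwR n))
      have h2 := h1.div_const ((w n : ℂ) ^ m)
      have h3 : (f (c, (w n : ℂ)) - ∑ j ∈ Finset.range (m+1), α j c * (w n : ℂ) ^ j) / (w n : ℂ) ^ m
        = (f (c, (w n : ℂ)) - ∑ j ∈ Finset.range m, α j c * (w n : ℂ) ^ j) / (w n : ℂ) ^ m
          - α m c := by
        rw [Finset.sum_range_succ]; field_simp; ring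
      rw [h3] at h2
      have hg : HasSum (fun i : ℕ => C / r ^ m * (w n / r) * (1/2 : ℝ) ^ i)
          (C / r ^ m * (w n / r) * 2) := hasSum_geometric_two.mul_left _
      have h4 := tsum_of_norm_bounded hg (f := fun i => α (i + (m+1)) c * (w n : ℂ) ^ (i + (m+1)) / (w n : ℂ) ^ m) ?_
      · rw [h2.tsum_eq] at h4
        refine h4.trans (le_of_eq (by ring))
      · intro i
        have h5 := hC c hc (i + (m+1))
        have h6 : ‖α (i + (m+1)) c * (w n : ℂ) ^ (i + (m+1)) / (w n : ℂ) ^ m‖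
            = ‖α (i + (m+1)) c‖ * (w n) ^ (i+1) := by
          have : α (i + (m+1)) c * (w n : ℂ) ^ (i + (m+1)) / (w n : ℂ) ^ m
            = α (i + (m+1)) c * (w n : ℂ) ^ (i + 1) := by field_simp; ring
          rw [this, norm_mul, norm_pow, Complex.norm_real, Real.norm_of_nonneg (hw0 n).le]
        rw [h6]
        have hwn := hw0 n
        have alg : ∀ W : ℝ, C / r ^ (i + (m+1)) * W ^ (i+1) = C / r ^ m * (W / r) * (W / r) ^ i := by
          intro W
          rw [div_pow, pow_add r, pow_succ r m, pow_succ W i]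
          field_simp
        calc _ ≤ C / r ^ (i + (m+1)) * (w n) ^ (i+1) := by gcongr
          _ = C / r ^ m * (w n / r) * (w n / r) ^ i := by exact alg _
          _ ≤ _ := by
            have := hwr n
            gcongr
    have hw_lim : Tendsto (fun n => 2 * C / r ^ m * (w n / r)) atTop (𝓝 0) := by
      have h1 : Tendsto (fun n : ℕ => (1 : ℝ) / ((n + 2 : ℕ) : ℝ)) atTop (𝓝 0) :=
        (tendsto_add_atTop_iff_nat (f := fun n : ℕ => (1 : ℝ) / (n : ℝ)) 2).2 tendsto_one_div_atTop_nhds_zero_nat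
      have h2 := h1.const_mul (2 * C / r ^ m)
      rw [mul_zero] at h2
      refine h2.congr fun n => ?_
      simp only [hw]; push_cast; field_simp
    rw [Metric.tendstoUniformlyOn_iff]
    intro ε hε
    filter_upwards [hw_lim.eventually_lt_const hε] with n hn c hc
    rw [dist_comm, dist_eq_norm]
    exact (key n c hc).trans_lt hn

lemma aux_det_diff {E ι : Type*} [NormedAddCommGroup E] [NormedSpace ℂ E] [Fintype ι]
    [DecidableEq ι] {U : Set E} {X : E → Matrix ι ι ℂ}
    (hX : ∀ i j, DifferentiableOn ℂ (fun c => X c i j) U) :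
    DifferentiableOn ℂ (fun c => (X c).det) U := by
  simp only [Matrix.det_apply']
  refine DifferentiableOn.fun_sum fun σ _ => ?_
  refine DifferentiableOn.const_mul ?_ _
  have h : ∀ s : Finset ι, DifferentiableOn ℂ (fun c => ∏ i ∈ s, X c (σ i) i) U := by
    intro s
    induction s using Finset.induction_on with
    | empty => simp
    | insert a s ha ih =>
      simp only [Finset.prod_insert ha]
      exact (hX _ _).mul ih
  exact h _

lemma aux_adj_diff {E ι : Type*} [NormedAddCommGroup E] [NormedSpace ℂ E] [Fintype ι]
    [DecidableEq ι] {U : Set E} {X : E → Matrix ι ι ℂ}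
    (hX : ∀ i j, DifferentiableOn ℂ (fun c => X c i j) U) (i j : ι) :
    DifferentiableOn ℂ (fun c => (X c).adjugate i j) U := by
  simp only [Matrix.adjugate_apply]
  refine aux_det_diff fun k l => ?_
  simp only [Matrix.updateRow_apply]
  split_ifs
  · exact differentiableOn_const _
  · exact hX _ _

lemma aux_mulVec_diff {E ι : Type*} [NormedAddCommGroup E] [NormedSpace ℂ E] [Fintype ι]
    {U : Set E} {X : E → Matrix ι ι ℂ} {v : E → ι → ℂ}
    (hX : ∀ i j, DifferentiableOn ℂ (fun c => X c i j) U)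
    (hv : ∀ i, DifferentiableOn ℂ (fun c => v c i) U) (i : ι) :
    DifferentiableOn ℂ (fun c => (X c).mulVec (v c) i) U := by
  simp only [Matrix.mulVec, dotProduct]
  exact DifferentiableOn.fun_sum fun j _ => (hX i j).mul (hv j)

lemma aux_shift_diff {E ι : Type*} [NormedAddCommGroup E] [NormedSpace ℂ E] [Fintype ι]
    [DecidableEq ι] {U : Set E} {X : E → Matrix ι ι ℂ}
    (hX : ∀ i j, DifferentiableOn ℂ (fun c => X c i j) U) (s : ℂ) (i j : ι) :
    DifferentiableOn ℂ (fun c => (s • (1 : Matrix ι ι ℂ) - X c) i j) U := by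
  simp only [Matrix.sub_apply]
  exact (differentiableOn_const _).fun_sub (hX i j)

/-- Solve the recursion up to order `n`. -/
lemma aux_rec_fin {E ι : Type*} [NormedAddCommGroup E] [NormedSpace ℂ E] [Fintype ι]
    [DecidableEq ι] {U : Set E} (T : ℕ → E → Matrix ι ι ℂ)
    (hT : ∀ n i j, DifferentiableOn ℂ (fun c => T n c i j) U) (v0 : ι → ℂ) (n : ℕ) :
    ∃ (k : E → ℂ) (q : ℕ → E → ι → ℂ), DifferentiableOn ℂ k U ∧
      (∀ m i, DifferentiableOn ℂ (fun c => q m c i) U) ∧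
      (∀ m : ℕ, 1 ≤ m → m ≤ n → ∀ c, ((m : ℂ) • (1 : Matrix ι ι ℂ) - T 0 c).mulVec (q m c)
        = ∑ i ∈ Finset.range m, (T (m - i) c).mulVec (q i c)) ∧
      (∀ c, q 0 c = k c • v0) ∧
      (∀ c, (∀ m : ℕ, 1 ≤ m → ((m : ℂ) • (1 : Matrix ι ι ℂ) - T 0 c).det ≠ 0) → k c ≠ 0) := by
  induction n with
  | zero =>
    refine ⟨fun _ => 1, fun _ _ => v0, differentiableOn_const _, fun _ _ => differentiableOn_const _,
      fun m h1 h2 => by omega, fun c => by simp, fun c _ => one_ne_zero⟩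
  | succ n ih =>
    obtain ⟨k, q, hk, hq, heq, h0, hne⟩ := ih
    set S : E → Matrix ι ι ℂ := fun c => ((n + 1 : ℕ) : ℂ) • (1 : Matrix ι ι ℂ) - T 0 c with hS
    have hSd := aux_shift_diff (hT 0) ((n + 1 : ℕ) : ℂ)
    have hdet : DifferentiableOn ℂ (fun c => (S c).det) U := aux_det_diff hSd
    set rhs : E → ι → ℂ := fun c => ∑ i ∈ Finset.range (n+1), (T (n + 1 - i) c).mulVec (q i c)
      with hrhs
    have hrd : ∀ i, DifferentiableOn ℂ (fun c => rhs c i) U := by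
      intro i
      simp only [hrhs, Finset.sum_apply]
      exact DifferentiableOn.fun_sum fun j _ => aux_mulVec_diff (hT _) (hq _) i
    refine ⟨fun c => (S c).det * k c,
      fun m c => if m ≤ n then (S c).det • q m c else (S c).adjugate.mulVec (rhs c),
      hdet.mul hk, ?_, ?_, ?_, ?_⟩
    · intro m i
      by_cases hm : m ≤ n
      · simp only [hm, if_true, Pi.smul_apply, smul_eq_mul]
        exact hdet.mul (hq m i)
      · simp only [hm, if_false]
        exact aux_mulVec_diff (aux_adj_diff hSd) hrd i
    · intro m h1 h2 c
      have hsum : ∑ i ∈ Finset.range m, (T (m - i) c).mulVec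
          (if i ≤ n then (S c).det • q i c else (S c).adjugate.mulVec (rhs c))
          = (S c).det • ∑ i ∈ Finset.range m, (T (m - i) c).mulVec (q i c) := by
        rw [Finset.smul_sum]
        refine Finset.sum_congr rfl fun i hi => ?_
        have : i ≤ n := by have := Finset.mem_range.1 hi; omega
        simp only [this, if_true, Matrix.mulVec_smul]
      rw [hsum]
      by_cases hm : m ≤ n
      · simp only [hm, if_true, Matrix.mulVec_smul]
        rw [heq m h1 hm c]
      · have hm' : m = n + 1 := by omega
        subst hm'
        simp only [hm, if_false]
        rw [Matrix.mulVec_mulVec]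
        change (S c * (S c).adjugate).mulVec _ = _
        rw [Matrix.mul_adjugate, Matrix.smul_mulVec, Matrix.one_mulVec]
    · intro c
      simp [h0, smul_smul]
    · intro c hc
      exact mul_ne_zero (hc (n+1) (by omega)) (hne c hc)

/-- Extension of a finite solution of the recursion. -/
noncomputable def auxSeq {E ι : Type*} [Fintype ι] [DecidableEq ι] (T : ℕ → E → Matrix ι ι ℂ)
    (q0 : ℕ → E → ι → ℂ) (M : ℕ) (c : E) (m : ℕ) : ι → ℂ :=
  if m ≤ M then q0 m c else
    (((m : ℂ) • (1 : Matrix ι ι ℂ) - T 0 c)⁻¹).mulVec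
      (∑ i : Fin m, (T (m - i) c).mulVec (auxSeq T q0 M c i))
termination_by m
decreasing_by exact i.2

lemma aux_lower {ι : Type*} [Fintype ι] [DecidableEq ι] (X : Matrix ι ι ℂ) (M : ℝ) (m : ℕ)
    (hM : ∀ v, ‖X.mulVec v‖ ≤ M * ‖v‖) (v : ι → ℂ) :
    ((m : ℝ) - M) * ‖v‖ ≤ ‖((m : ℂ) • (1 : Matrix ι ι ℂ) - X).mulVec v‖ := by
  rw [Matrix.sub_mulVec, Matrix.smul_mulVec, Matrix.one_mulVec]
  have h1 := norm_sub_norm_le ((m : ℂ) • v) (X.mulVec v)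
  rw [norm_smul, Complex.norm_natCast] at h1
  have := hM v
  linarith

lemma aux_det_ne {ι : Type*} [Fintype ι] [DecidableEq ι] (X : Matrix ι ι ℂ) (M m : ℕ)
    (hM : ∀ v, ‖X.mulVec v‖ ≤ M * ‖v‖) (hm : M < m) :
    ((m : ℂ) • (1 : Matrix ι ι ℂ) - X).det ≠ 0 := by
  intro h
  obtain ⟨v, hv, hv0⟩ := Matrix.exists_mulVec_eq_zero_iff.2 h
  have h1 := aux_lower X M m hM v
  rw [hv0, norm_zero] at h1
  have h2 : 0 < ‖v‖ := norm_pos_iff.2 hv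
  have h3 : (M : ℝ) < m := by exact_mod_cast hm
  nlinarith

lemma aux_rec {E ι : Type*} [NormedAddCommGroup E] [NormedSpace ℂ E] [Fintype ι]
    [DecidableEq ι] {U : Set E} (T : ℕ → E → Matrix ι ι ℂ)
    (hT : ∀ n i j, DifferentiableOn ℂ (fun c => T n c i j) U) (v0 : ι → ℂ) (M : ℕ)
    (hM : ∀ c ∈ U, ∀ v, ‖(T 0 c).mulVec v‖ ≤ M * ‖v‖) :
    ∃ (k : E → ℂ) (q : ℕ → E → ι → ℂ), DifferentiableOn ℂ k U ∧
      (∀ m i, DifferentiableOn ℂ (fun c => q m c i) U) ∧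
      (∀ m : ℕ, 1 ≤ m → ∀ c ∈ U, ((m : ℂ) • (1 : Matrix ι ι ℂ) - T 0 c).mulVec (q m c)
        = ∑ i ∈ Finset.range m, (T (m - i) c).mulVec (q i c)) ∧
      (∀ c, q 0 c = k c • v0) ∧
      (∀ c, (∀ m : ℕ, 1 ≤ m → ((m : ℂ) • (1 : Matrix ι ι ℂ) - T 0 c).det ≠ 0) → k c ≠ 0) := by
  obtain ⟨k, q0, hk, hq, heq, h0, hne⟩ := aux_rec_fin T hT v0 M
  have hle : ∀ m ≤ M, ∀ c, auxSeq T q0 M c m = q0 m c := by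
    intro m hm c
    rw [auxSeq, if_pos hm]
  have hgt : ∀ m, ¬ m ≤ M → ∀ c, auxSeq T q0 M c m =
      (((m : ℂ) • (1 : Matrix ι ι ℂ) - T 0 c)⁻¹).mulVec
      (∑ i ∈ Finset.range m, (T (m - i) c).mulVec (auxSeq T q0 M c i)) := by
    intro m hm c
    rw [auxSeq, if_neg hm, Finset.sum_range]
  refine ⟨k, fun m c => auxSeq T q0 M c m, hk, ?_, ?_, fun c => (hle 0 (by omega) c).trans (h0 c), hne⟩
  · intro m
    induction m using Nat.strong_induction_on with
    | _ m ih =>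
    intro i
    by_cases hm : m ≤ M
    · simp only [hle m hm]
      exact hq m i
    · simp only [hgt m hm]
      refine aux_mulVec_diff ?_ ?_ i
      · intro a b
        have hSd := aux_shift_diff (hT 0) (m : ℂ)
        have h1 : DifferentiableOn ℂ (fun c => (((m : ℂ) • (1 : Matrix ι ι ℂ) - T 0 c).det)⁻¹
            * ((m : ℂ) • (1 : Matrix ι ι ℂ) - T 0 c).adjugate a b) U :=
          ((aux_det_diff hSd).fun_inv fun c hc =>
            aux_det_ne _ M m (hM c hc) (by omega)).mul (aux_adj_diff hSd a b)
        refine h1.congr fun c hc => ?_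
        rw [Matrix.inv_def, Ring.inverse_eq_inv', Matrix.smul_apply, smul_eq_mul]
      · intro b
        simp only [Finset.sum_apply]
        exact DifferentiableOn.fun_sum fun j hj =>
          aux_mulVec_diff (hT _) (ih j (Finset.mem_range.1 hj)) b
  · intro m h1 c hc
    by_cases hm : m ≤ M
    · simp only []
      rw [hle m hm, heq m h1 hm]
      refine Finset.sum_congr rfl fun i hi => ?_
      rw [hle i (by have := Finset.mem_range.1 hi; omega)]
    · simp only []
      rw [hgt m hm, Matrix.mulVec_mulVec, Matrix.mul_nonsing_inv, Matrix.one_mulVec]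
      exact (aux_det_ne _ M m (hM c hc) (by omega)).isUnit

lemma aux_growth (q : ℕ → ℝ) (hq : ∀ m, 0 ≤ q m) (ε : ℝ) (hε : 0 ≤ ε) (M : ℕ)
    (h : ∀ m, M < m → q m ≤ ε * ∑ i ∈ Finset.range m, q i) (m : ℕ) :
    ∑ i ∈ Finset.range (m+1), q i ≤ (∑ i ∈ Finset.range (M+1), q i) * (1 + ε) ^ m := by
  have hS : ∀ n, 0 ≤ ∑ i ∈ Finset.range n, q i := fun n => Finset.sum_nonneg fun i _ => hq i
  have hsmall : ∀ m ≤ M,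
      ∑ i ∈ Finset.range (m+1), q i ≤ (∑ i ∈ Finset.range (M+1), q i) * (1 + ε) ^ m := by
    intro m hm
    calc _ ≤ ∑ i ∈ Finset.range (M+1), q i :=
          Finset.sum_le_sum_of_subset_of_nonneg
            (Finset.range_subset_range.2 (by omega)) fun i _ _ => hq i
      _ ≤ _ := le_mul_of_one_le_right (hS _) (one_le_pow₀ (by linarith))
  induction m with
  | zero => exact hsmall 0 (by omega)
  | succ m ih =>
    by_cases hm : m + 1 ≤ M
    · exact hsmall _ hm
    · rw [Finset.sum_range_succ]
      have h1 := h (m+1) (by omega)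
      calc _ ≤ (∑ i ∈ Finset.range (m+1), q i) * (1 + ε) := by linarith
        _ ≤ ((∑ i ∈ Finset.range (M+1), q i) * (1 + ε) ^ m) * (1 + ε) := by gcongr
        _ = _ := by ring

/-- Parametric Fuchsian systems: the abstract vector-valued version. -/
lemma aux_main {E ι : Type*} [NormedAddCommGroup E] [NormedSpace ℂ E] [ProperSpace E] [Fintype ι]
    [DecidableEq ι] {R : ℝ} (hR : 0 < R) {U : Set E} (hU : IsOpen U) (T : E × ℂ → Matrix ι ι ℂ)
    (hT : ∀ i j, DifferentiableOn ℂ (fun z => T z i j) (Set.univ ×ˢ ball (0 : ℂ) R))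
    (v0 : ι → ℂ) (hv0 : ∀ c, (T (c, 0)).mulVec v0 = 0) (M : ℕ)
    (hM : ∀ c ∈ U, ∀ v, ‖(T (c, 0)).mulVec v‖ ≤ M * ‖v‖) :
    ∃ (Q : E → ℂ → ι → ℂ) (k : E → ℂ),
      (∀ i, DifferentiableOn ℂ (fun z : E × ℂ => Q z.1 z.2 i) (U ×ˢ ball (0 : ℂ) R)) ∧
      DifferentiableOn ℂ k U ∧
      (∀ c ∈ U, ∀ z ∈ ball (0 : ℂ) R, ∀ i,
        z * deriv (fun w => Q c w i) z = (T (c, z)).mulVec (Q c z) i) ∧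
      (∀ c ∈ U, Q c 0 = k c • v0) ∧
      (∀ c ∈ U, (∀ m : ℕ, 1 ≤ m → ((m : ℂ) • (1 : Matrix ι ι ℂ) - T (c, 0)).det ≠ 0) →
        k c ≠ 0) := by
  choose α hαd hαs hα0 hαb using fun i j => aux_coeff hR (hT i j)
  set Tm : ℕ → E → Matrix ι ι ℂ := fun n c => Matrix.of fun i j => α i j n c with hTm
  have hTm0 : ∀ c, Tm 0 c = T (c, 0) := by
    intro c; ext i j; simp [hTm, hα0]
  obtain ⟨k, q, hk, hq, heq, hq0, hne⟩ := aux_rec (U := U) Tm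
    (fun n i j => (hαd i j n).differentiableOn) v0 M (by simpa only [hTm0] using hM)
  -- norm bounds for the coefficient matrices
  have hTb : ∀ c0, ∀ r, 0 < r → r < R → ∃ C, 0 ≤ C ∧ ∀ c ∈ ball c0 1, ∀ n v,
      ‖(Tm n c).mulVec v‖ ≤ C / r ^ n * ‖v‖ := by
    intro c0 r hr hrR
    choose C hC0 hC using fun i j => hαb i j c0 r hr hrR
    have hnn : 0 ≤ ∑ i, ∑ j, C i j := Finset.sum_nonneg fun i _ => Finset.sum_nonneg fun j _ => hC0 i j
    refine ⟨∑ i, ∑ j, C i j, hnn, fun c hc n v => ?_⟩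
    refine (pi_norm_le_iff_of_nonneg (by positivity)).2 fun i => ?_
    calc ‖(Tm n c).mulVec v i‖ = ‖∑ j, α i j n c * v j‖ := rfl
      _ ≤ ∑ j, ‖α i j n c * v j‖ := norm_sum_le _ _
      _ ≤ ∑ j, C i j / r ^ n * ‖v‖ := by
        refine Finset.sum_le_sum fun j _ => ?_
        rw [norm_mul]
        have := hC i j c hc n
        have h2 := norm_le_pi_norm v j
        have h3 := hC0 i j
        gcongr
      _ = (∑ j, C i j) / r ^ n * ‖v‖ := by rw [← Finset.sum_mul, Finset.sum_div]
      _ ≤ (∑ i, ∑ j, C i j) / r ^ n * ‖v‖ := by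
        gcongr ?_ / _ * _
        exact Finset.single_le_sum (f := fun i => ∑ j, C i j)
          (fun i _ => Finset.sum_nonneg fun j _ => hC0 i j) (Finset.mem_univ i)
  -- local bounds for the solution
  have hqb : ∀ c0 ∈ U, ∀ s, 0 < s → s < R → ∃ W ∈ 𝓝 c0, W ⊆ U ∧ ∃ u : ℕ → ℝ, Summable u ∧
      ∀ c ∈ W, ∀ z : ℂ, ‖z‖ ≤ s → ∀ m i, ‖q m c i * z ^ m‖ ≤ u m := by
    intro c0 hc0 s hs hsR
    obtain ⟨r, hsr, hrR⟩ := exists_between hsR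
    have hr : 0 < r := hs.trans hsr
    obtain ⟨C, hC0, hC⟩ := hTb c0 r hr hrR
    set ε : ℝ := (r / s - 1) / 2 with hε
    have hε0 : 0 < ε := by
      have : 1 < r / s := (one_lt_div hs).2 hsr
      rw [hε]; linarith
    set θ : ℝ := (1 + ε) * (s / r) with hθ
    have hθ0 : 0 ≤ θ := by positivity
    have hθ1 : θ < 1 := by
      have h1 : θ = (1 + s / r) / 2 := by rw [hθ, hε]; field_simp; ring
      have h2 : s / r < 1 := (div_lt_one hr).2 hsr
      rw [h1]; linarith
    set M' : ℕ := M + ⌈C / ε⌉₊ with hM'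
    have hcont : ContinuousAt (fun c => ∑ m ∈ Finset.range (M'+1), ‖q m c‖ * r ^ m) c0 := by
      refine tendsto_finsetSum _ fun m _ => ?_
      refine Tendsto.mul_const _ (Tendsto.norm ?_)
      refine tendsto_pi_nhds.2 fun i => ?_
      exact ((hq m i).continuousOn.continuousAt (hU.mem_nhds hc0))
    obtain ⟨B, hB⟩ : ∃ B, (∑ m ∈ Finset.range (M'+1), ‖q m c0‖ * r ^ m) < B := exists_gt _
    refine ⟨{c | (∑ m ∈ Finset.range (M'+1), ‖q m c‖ * r ^ m) < B} ∩ (ball c0 1 ∩ U),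
      inter_mem (hcont.eventually_lt_const hB) (inter_mem (ball_mem_nhds _ one_pos) (hU.mem_nhds hc0)),
      fun c hc => hc.2.2, fun m => B * θ ^ m,
      (summable_geometric_of_lt_one hθ0 hθ1).mul_left _, ?_⟩
    rintro c ⟨hcB, hcb, hcU⟩ z hz m i
    have hcB' : (∑ m ∈ Finset.range (M'+1), ‖q m c‖ * r ^ m) < B := hcB
    have hgr := aux_growth (fun m => ‖q m c‖ * r ^ m) (fun m => by positivity) ε hε0.le M' (by
      intro m hm
      have h1 := aux_lower (Tm 0 c) M m (by rw [hTm0]; exact hM c hcU) (q m c)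
      rw [heq m (by omega) c hcU] at h1
      have h2 : ‖∑ i ∈ Finset.range m, (Tm (m - i) c).mulVec (q i c)‖
          ≤ ∑ i ∈ Finset.range m, C / r ^ (m - i) * ‖q i c‖ :=
        (norm_sum_le _ _).trans (Finset.sum_le_sum fun i _ => hC c hcb _ _)
      have h3 : (∑ i ∈ Finset.range m, C / r ^ (m - i) * ‖q i c‖) * r ^ m
          = C * ∑ i ∈ Finset.range m, ‖q i c‖ * r ^ i := by
        rw [Finset.sum_mul, Finset.mul_sum]
        refine Finset.sum_congr rfl fun i hi => ?_
        have : r ^ m = r ^ (m - i) * r ^ i := by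
          rw [← pow_add]; congr 1; have := Finset.mem_range.1 hi; omega
        rw [this]; field_simp
      have hS : 0 ≤ ∑ i ∈ Finset.range m, ‖q i c‖ * r ^ i :=
        Finset.sum_nonneg fun i _ => by positivity
      have h4 : C / ε ≤ (m : ℝ) - M := by
        have h5 := Nat.le_ceil (C / ε)
        have h6 : ((M + ⌈C / ε⌉₊ : ℕ) : ℝ) ≤ m := by exact_mod_cast hm.le
        push_cast at h6
        linarith
      have h4' : 0 < (m : ℝ) - M := by
        have : (M : ℝ) < m := by exact_mod_cast (by omega : M < m)
        linarith
      rw [div_le_iff₀ hε0] at h4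
      have h7 : ((m : ℝ) - M) * (‖q m c‖ * r ^ m)
          ≤ ((m : ℝ) - M) * (ε * ∑ i ∈ Finset.range m, ‖q i c‖ * r ^ i) := by
        calc _ = (((m : ℝ) - M) * ‖q m c‖) * r ^ m := by ring
          _ ≤ (∑ i ∈ Finset.range m, C / r ^ (m - i) * ‖q i c‖) * r ^ m := by
            have := h1.trans h2
            gcongr
          _ = C * ∑ i ∈ Finset.range m, ‖q i c‖ * r ^ i := h3
          _ ≤ (((m : ℝ) - M) * ε) * ∑ i ∈ Finset.range m, ‖q i c‖ * r ^ i := by gcongr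
          _ = _ := by ring
      exact le_of_mul_le_mul_left h7 h4') m
    have h8 : ‖q m c‖ * r ^ m ≤ B * (1 + ε) ^ m := by
      calc ‖q m c‖ * r ^ m ≤ ∑ i ∈ Finset.range (m+1), ‖q i c‖ * r ^ i :=
            Finset.single_le_sum (f := fun i => ‖q i c‖ * r ^ i) (fun i _ => by positivity)
              (Finset.mem_range.2 (by omega))
        _ ≤ _ := hgr
        _ ≤ _ := by gcongr
    rw [norm_mul, norm_pow]
    have h9 := norm_le_pi_norm (q m c) i
    calc ‖q m c i‖ * ‖z‖ ^ m ≤ ‖q m c‖ * s ^ m := by gcongr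
      _ = (‖q m c‖ * r ^ m) * (s / r) ^ m := by rw [div_pow]; field_simp
      _ ≤ (B * (1 + ε) ^ m) * (s / r) ^ m := by gcongr
      _ = B * θ ^ m := by rw [hθ, mul_pow]; ring
  have hbetween : ∀ z ∈ ball (0 : ℂ) R, ∃ s, 0 < s ∧ s < R ∧ ‖z‖ < s := by
    intro z hz
    rw [mem_ball, dist_zero_right] at hz
    obtain ⟨s, h1, h2⟩ := exists_between hz
    exact ⟨s, (norm_nonneg _).trans_lt h1, h2, h1⟩
  refine ⟨fun c z i => ∑' m, q m c i * z ^ m, k, ?_, hk, ?_, ?_, ?_⟩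
  · intro i
    refine aux_limit (hU.prod isOpen_ball)
      (f := fun n x => ∑ m ∈ Finset.range n, q m x.1 i * x.2 ^ m) ?_ ?_
    · intro n
      refine DifferentiableOn.fun_sum fun m _ => ?_
      refine DifferentiableOn.mul ?_ ?_
      · exact (hq m i).comp (f := fun x : E × ℂ => x.1) (by fun_prop) (fun x hx => hx.1)
      · fun_prop
    · rintro ⟨c0, z0⟩ ⟨hc0, hz0⟩
      obtain ⟨s, hs, hsR, hzs⟩ := hbetween z0 hz0
      obtain ⟨W, hW, hWU, u, hu, hb⟩ := hqb c0 hc0 s hs hsR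
      refine ⟨W ×ˢ ball (0 : ℂ) s, prod_mem_nhds hW (isOpen_ball.mem_nhds (by simpa using hzs)), ?_⟩
      refine tendstoUniformlyOn_tsum_nat hu ?_
      rintro m ⟨c, z⟩ ⟨hc, hz⟩
      exact hb c hc z (by simpa using (mem_ball.1 hz).le) m i
  · intro c hc z hz i
    obtain ⟨s, hs, hsR, hzs⟩ := hbetween z hz
    obtain ⟨W, hW, hWU, u, hu, hb⟩ := hqb c hc s hs hsR
    have hbc := hb c (mem_of_mem_nhds hW)
    have h1 := Complex.hasSum_deriv_of_summable_norm (F := fun m w => q m c i * w ^ m) hu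
      (fun m => by fun_prop) isOpen_ball
      (fun m w hw => hbc w (by simpa using (mem_ball.1 hw).le) m i)
      (show z ∈ ball (0 : ℂ) s by simpa using hzs)
    have h2 := h1.mul_left z
    have h3 : ∀ j, HasSum (fun n => ∑ l ∈ Finset.range (n+1),
        (q l c j * z ^ l) * (α i j (n - l) c * z ^ (n - l)))
        ((∑' m, q m c j * z ^ m) * T (c, z) i j) := by
      intro j
      have hsq : Summable fun m => ‖q m c j * z ^ m‖ :=
        Summable.of_nonneg_of_le (fun _ => norm_nonneg _) (fun m => hbc z hzs.le m j) hu
      have hsa : Summable fun m => ‖α i j m c * z ^ m‖ := (hαs i j c z hz).summable.norm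
      have h4 := tsum_mul_tsum_eq_tsum_sum_range_of_summable_norm hsq hsa
      rw [(hαs i j c z hz).tsum_eq] at h4
      rw [h4]
      exact (summable_norm_sum_mul_range_of_summable_norm hsq hsa).of_norm.hasSum
    have h5 : HasSum (fun n => ∑ j, ∑ l ∈ Finset.range (n+1),
        (q l c j * z ^ l) * (α i j (n - l) c * z ^ (n - l)))
        (∑ j, (∑' m, q m c j * z ^ m) * T (c, z) i j) := hasSum_sum fun j _ => h3 j
    have h6 : (fun n => ∑ j, ∑ l ∈ Finset.range (n+1),
        (q l c j * z ^ l) * (α i j (n - l) c * z ^ (n - l)))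
        = fun m => z * deriv (fun w => q m c i * w ^ m) z := by
      funext n
      have hn : (n : ℂ) • q n c = ∑ l ∈ Finset.range (n+1), (Tm (n - l) c).mulVec (q l c) := by
        rw [Finset.sum_range_succ, Nat.sub_self]
        rcases Nat.eq_zero_or_pos n with h0 | h0
        · subst h0
          simp [hTm0, hq0, Matrix.mulVec_smul, hv0]
        · have := heq n h0 c hc
          rw [← this, Matrix.sub_mulVec, Matrix.smul_mulVec, Matrix.one_mulVec]
          simp
      have hni := congrFun hn i
      rw [Pi.smul_apply, smul_eq_mul, Finset.sum_apply] at hni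
      have hd : z * deriv (fun w => q n c i * w ^ n) z = (n * q n c i) * z ^ n := by
        rw [deriv_const_mul _ (by fun_prop), deriv_pow_field]
        rcases Nat.eq_zero_or_pos n with h0 | h0
        · subst h0; simp
        · obtain ⟨m, rfl⟩ := Nat.exists_eq_succ_of_ne_zero h0.ne'
          simp [pow_succ]; ring
      rw [hd, hni, Finset.sum_comm, Finset.sum_mul]
      refine Finset.sum_congr rfl fun l hl => ?_
      have hln : z ^ n = z ^ l * z ^ (n - l) := by
        rw [← pow_add]; congr 1; have := Finset.mem_range.1 hl; omega
      simp only [Matrix.mulVec, dotProduct, hTm, Matrix.of_apply, Finset.sum_mul]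
      refine Finset.sum_congr rfl fun j _ => ?_
      rw [hln]; ring
    rw [h6] at h5
    have h7 := h2.unique h5
    simp only [Matrix.mulVec, dotProduct]
    refine h7.trans (Finset.sum_congr rfl fun j _ => mul_comm _ _)
  · intro c hc
    funext i
    simp only []
    rw [tsum_eq_single 0 (fun m hm => by simp [hm])]
    simp [hq0]
  · intro c hc h
    exact hne c (by simpa only [hTm0] using h)

lemma aux_sylvester {N : ℕ} (a X : Matrix (Fin N) (Fin N) ℂ) (m : ℕ) (hm : 1 ≤ m)
    (hX : (m : ℂ) • X = a * X - X * a)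
    (hnr : ∀ μ ν : ℂ, (Matrix.charpoly a).IsRoot μ → (Matrix.charpoly a).IsRoot ν →
          ∀ t : ℤ, μ - ν = (t : ℂ) → t = 0) : X = 0 := by
  set b : Matrix (Fin N) (Fin N) ℂ := algebraMap ℂ _ (m : ℂ) + a with hb
  have hs : X * b = a * X := by
    rw [hb, mul_add, ← Algebra.commutes, ← Algebra.smul_def, hX]; abel
  have hsemi : ∀ p : Polynomial ℂ, X * Polynomial.aeval b p = Polynomial.aeval a p * X := by
    intro p
    induction p using Polynomial.induction_on' with
    | add p q hp hq => rw [map_add, map_add, mul_add, add_mul, hp, hq]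
    | monomial n r =>
      have h1 : X * b ^ n = a ^ n * X := by
        have : SemiconjBy X b a := hs
        exact this.pow_right n
      rw [Polynomial.aeval_monomial, Polynomial.aeval_monomial, ← mul_assoc, ← Algebra.commutes,
        mul_assoc, h1, mul_assoc]
  have h0 := hsemi a.charpoly
  rw [Matrix.aeval_self_charpoly, zero_mul] at h0
  rcases Nat.eq_zero_or_pos N with hN | hN
  · subst hN
    ext i; exact i.elim0
  have hu : IsUnit (Polynomial.aeval b a.charpoly) := by
    by_contra hnu
    have h1 : (0 : ℂ) ∈ spectrum ℂ (Polynomial.aeval b a.charpoly) := spectrum.zero_mem_iff ℂ |>.2 hnu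
    rw [spectrum.map_polynomial_aeval_of_degree_pos b a.charpoly (by
      rw [Matrix.charpoly_degree_eq_dim]; simpa using hN)] at h1
    obtain ⟨μ, hμ, hμ0⟩ := h1
    have h2 : μ - m ∈ spectrum ℂ a := by
      rw [hb] at hμ
      refine (spectrum.add_mem_add_iff (s := (m : ℂ))).1 ?_
      rw [sub_add_cancel]
      exact hμ
    have h3 := hnr μ (μ - m) hμ0 (Matrix.mem_spectrum_iff_isRoot_charpoly.1 h2) m (by simp)
    omega
  obtain ⟨P, hP⟩ := hu
  rw [← hP] at h0
  have := congrArg (· * (↑P⁻¹ : Matrix (Fin N) (Fin N) ℂ)) h0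
  simpa [mul_assoc] using this

lemma aux_jacobi {N : ℕ} (X : ℂ → Matrix (Fin N) (Fin N) ℂ) (X' : Matrix (Fin N) (Fin N) ℂ) (z : ℂ)
    (h : ∀ i j, HasDerivAt (fun w => X w i j) (X' i j) z) :
    HasDerivAt (fun w => (X w).det) (X' * (X z).adjugate).trace z := by
  let f : ContinuousMultilinearMap ℂ (fun _ : Fin N => Fin N → ℂ) ℂ :=
    ⟨(Matrix.detRowAlternating (n := Fin N) (R := ℂ)).toMultilinearMap,
      (continuous_id.matrix_det : Continuous fun M : Matrix (Fin N) (Fin N) ℂ => M.det)⟩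
  have hf : ∀ M : Fin N → Fin N → ℂ, f M = Matrix.det (Matrix.of M) := fun M => rfl
  have hd : HasDerivAt (fun w i j => X w i j) (fun i j => X' i j) z :=
    hasDerivAt_pi.2 fun i => hasDerivAt_pi.2 fun j => h i j
  have h1 := (f.hasFDerivAt (fun i j => X z i j)).comp_hasDerivAt z hd
  have h2 : f.linearDeriv (fun i j => X z i j) (fun i j => X' i j) = (X' * (X z).adjugate).trace := by
    rw [ContinuousMultilinearMap.linearDeriv_apply, Matrix.trace]
    refine Finset.sum_congr rfl fun i _ => ?_
    have h3 : f (Function.update (fun i j => X z i j) i (fun j => X' i j))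
        = ((X z).updateRow i (X' i)).det := rfl
    rw [h3, Matrix.det_eq_sum_mul_adjugate_row _ i, Matrix.diag_apply, Matrix.mul_apply]
    refine Finset.sum_congr rfl fun j _ => ?_
    rw [Matrix.updateRow_self, Matrix.adjugate_apply, Matrix.adjugate_apply, Matrix.updateRow_idem]
  rw [h2] at h1
  exact h1

/-- A scalar Fuchsian equation has no zeros away from the origin. -/
lemma aux_nonvanish {R : ℝ} {f g : ℂ → ℂ} (hf : DifferentiableOn ℂ f (ball 0 R))
    (hg : DifferentiableOn ℂ g (ball 0 R)) (hfg : ∀ z ∈ ball (0 : ℂ) R, z * deriv f z = g z * f z)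
    (h0 : f 0 ≠ 0) : ∀ z ∈ ball (0 : ℂ) R, f z ≠ 0 := by
  intro z hz hfz
  have hz0 : z ≠ 0 := by rintro rfl; exact h0 hfz
  have han : AnalyticOnNhd ℂ f (ball 0 R) := hf.analyticOnNhd isOpen_ball
  have hR : (0 : ℂ) ∈ ball (0 : ℂ) R := mem_ball_self (pos_of_mem_ball hz)
  have hne : ¬ ∀ᶠ w in 𝓝 z, f w = 0 := by
    intro h
    exact h0 (han.eqOn_zero_of_preconnected_of_eventuallyEq_zero
      (convex_ball _ _).isPreconnected hz h hR)
  obtain ⟨n, h, hh, hh0, hev⟩ := (han z hz).exists_eventuallyEq_pow_smul_nonzero_iff.2 hne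
  rcases Nat.eq_zero_or_pos n with hn | hn
  · subst hn
    have := hev.self_of_nhds
    simp only [pow_zero, one_smul] at this
    exact hh0 (this ▸ hfz)
  obtain ⟨m, rfl⟩ := Nat.exists_eq_succ_of_ne_zero hn.ne'
  have hF : ∀ᶠ w in 𝓝[≠] z, w * ((m + 1 : ℂ) * h w + (w - z) * deriv h w) - g w * ((w - z) * h w) = 0 := by
    have e1 := hev.eventually_nhds
    have e2 := hh.eventually_analyticAt
    filter_upwards [nhdsWithin_le_nhds e1, nhdsWithin_le_nhds e2,
      nhdsWithin_le_nhds (isOpen_ball.mem_nhds hz), self_mem_nhdsWithin] with w w1 w2 w3 w4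
    have w5 : w - z ≠ 0 := sub_ne_zero.2 w4
    have hd : HasDerivAt (fun w => (w - z) ^ (m+1) * h w)
        (((m + 1 : ℕ) * (w - z) ^ m * 1) * h w + (w - z) ^ (m+1) * deriv h w) w := by
      have := (((hasDerivAt_id w).sub_const z).pow (m+1)).mul w2.differentiableAt.hasDerivAt
      simpa using! this
    have hd' : deriv f w = _ := (EventuallyEq.deriv_eq (w1 : f =ᶠ[𝓝 w] _)).trans hd.deriv
    have w6 := hfg w w3
    rw [hd', w1.self_of_nhds, smul_eq_mul] at w6
    have : (w - z) ^ m * (w * ((m + 1 : ℂ) * h w + (w - z) * deriv h w) - g w * ((w - z) * h w)) = 0 := by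
      simp only [Nat.succ_eq_add_one] at w6
      push_cast at w6
      linear_combination w6
    exact (mul_eq_zero.1 this).resolve_left (pow_ne_zero _ w5)
  have hcF : ContinuousAt (fun w => w * ((m + 1 : ℂ) * h w + (w - z) * deriv h w) - g w * ((w - z) * h w)) z := by
    have c1 := hh.continuousAt
    have c2 := hh.deriv.continuousAt
    have c3 : ContinuousAt g z := hg.continuousOn.continuousAt (isOpen_ball.mem_nhds hz)
    fun_prop
  have hlim := hcF.tendsto.mono_left (nhdsWithin_le_nhds (s := {z}ᶜ))
  have hlim0 : Tendsto (fun w => w * ((m + 1 : ℂ) * h w + (w - z) * deriv h w) - g w * ((w - z) * h w))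
      (𝓝[≠] z) (𝓝 0) := (tendsto_congr' hF).2 tendsto_const_nhds
  have := tendsto_nhds_unique hlim hlim0
  simp only [sub_self, zero_mul, mul_zero, add_zero, sub_zero] at this
  have hm1 : (m + 1 : ℂ) ≠ 0 := by exact_mod_cast Nat.succ_ne_zero m
  exact mul_ne_zero hz0 (mul_ne_zero hm1 hh0) this

/-- The operator `X ↦ A X - X a` as a matrix. -/
noncomputable def auxOp {N : ℕ} (A a : Matrix (Fin N) (Fin N) ℂ) :
    Matrix (Fin N × Fin N) (Fin N × Fin N) ℂ :=
  Matrix.of fun x y => (if x.2 = y.2 then A x.1 y.1 else 0) - (if x.1 = y.1 then a y.2 x.2 else 0)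

lemma auxOp_mulVec {N : ℕ} (A a : Matrix (Fin N) (Fin N) ℂ) (v : Fin N × Fin N → ℂ) (i j : Fin N) :
    (auxOp A a).mulVec v (i, j) =
      (A * (Matrix.of fun i j => v (i, j)) - (Matrix.of fun i j => v (i, j)) * a) i j := by
  simp only [auxOp, Matrix.mulVec, dotProduct, Matrix.of_apply, Matrix.sub_apply, Matrix.mul_apply,
    sub_mul, Finset.sum_sub_distrib, Fintype.sum_prod_type, ite_mul, zero_mul]
  congr 1
  · simp
  · rw [Finset.sum_comm]
    simp [mul_comm]

theorem statement9 (N p : ℕ) (hN : 0 < N) (hp : 0 < p) (R : ℝ) (hR : 0 < R)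
    (a : (Fin p → ℂ) →ₗ[ℂ] Matrix (Fin N) (Fin N) ℂ)
    (A : (Fin p → ℂ) × ℂ → Matrix (Fin N) (Fin N) ℂ)
    (hA : ∀ i j, DifferentiableOn ℂ (fun z => A z i j)
      ((Set.univ : Set (Fin p → ℂ)) ×ˢ Metric.ball (0 : ℂ) R))
    (hA0 : ∀ c : Fin p → ℂ, A (c, 0) = a c)
    (U : Set (Fin p → ℂ)) (hUopen : IsOpen U) (hUbdd : Bornology.IsBounded U) :
    ∃ (Q : (Fin p → ℂ) → ℂ → Matrix (Fin N) (Fin N) ℂ) (k : (Fin p → ℂ) → ℂ),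
      (∀ i j, DifferentiableOn ℂ (fun z : (Fin p → ℂ) × ℂ => Q z.1 z.2 i j)
        (U ×ˢ Metric.ball (0 : ℂ) R)) ∧
      DifferentiableOn ℂ k U ∧
      (∀ c ∈ U, ∀ z ∈ Metric.ball (0 : ℂ) R, ∀ i j,
        z * deriv (fun w => Q c w i j) z = (A (c, z) * Q c z - Q c z * a c) i j) ∧
      (∀ c ∈ U, Q c 0 = k c • (1 : Matrix (Fin N) (Fin N) ℂ)) ∧
      (∀ c ∈ U,
        (∀ μ ν : ℂ, (Matrix.charpoly (a c)).IsRoot μ → (Matrix.charpoly (a c)).IsRoot ν →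
          ∀ t : ℤ, μ - ν = (t : ℂ) → t = 0) →
        k c ≠ 0 ∧ ∀ z ∈ Metric.ball (0 : ℂ) R, IsUnit (Q c z)) := by
  set T : (Fin p → ℂ) × ℂ → Matrix (Fin N × Fin N) (Fin N × Fin N) ℂ :=
    fun x => auxOp (A x) (a x.1) with hTdef
  -- the entries of `a` are linear functionals
  have ha : ∀ i j, Differentiable ℂ (fun c => a c i j) := by
    intro i j
    let φ : (Fin p → ℂ) →ₗ[ℂ] ℂ :=
      { toFun := fun c => a c i j
        map_add' := fun x y => by simp
        map_smul' := fun r x => by simp }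
    exact (LinearMap.toContinuousLinearMap φ).differentiable
  have hT : ∀ x y, DifferentiableOn ℂ (fun z => T z x y)
      ((Set.univ : Set (Fin p → ℂ)) ×ˢ ball (0 : ℂ) R) := by
    intro x y
    simp only [hTdef, auxOp, Matrix.of_apply]
    refine DifferentiableOn.fun_sub ?_ ?_
    · split_ifs
      · exact hA _ _
      · exact differentiableOn_const _
    · split_ifs
      · exact ((ha y.2 x.2).comp differentiable_fst).differentiableOn
      · exact differentiableOn_const _
  set v0 : Fin N × Fin N → ℂ := fun x => (1 : Matrix (Fin N) (Fin N) ℂ) x.1 x.2 with hv0def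
  have hv0 : ∀ c, (T (c, 0)).mulVec v0 = 0 := by
    intro c
    funext ⟨i, j⟩
    have h1 : (Matrix.of fun i j => v0 (i, j)) = (1 : Matrix (Fin N) (Fin N) ℂ) := rfl
    simp only [hTdef]
    rw [auxOp_mulVec, h1, hA0]
    simp
  have hMex : ∃ M : ℕ, ∀ c ∈ U, ∀ v, ‖(T (c, 0)).mulVec v‖ ≤ M * ‖v‖ := by
    have hent : ∀ x y, ∃ C, ∀ c ∈ closure U, ‖T (c, 0) x y‖ ≤ C := by
      intro x y
      refine hUbdd.isCompact_closure.exists_bound_of_continuousOn ?_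
      exact (hT x y).continuousOn.comp (f := fun c : Fin p → ℂ => (c, (0 : ℂ))) (by fun_prop)
        (fun c _ => ⟨Set.mem_univ _, mem_ball_self hR⟩)
    choose C hC using hent
    obtain ⟨M, hM⟩ := exists_nat_ge (∑ x, ∑ y, |C x y|)
    refine ⟨M, fun c hc v => ?_⟩
    refine (pi_norm_le_iff_of_nonneg (by positivity)).2 fun x => ?_
    calc ‖(T (c, 0)).mulVec v x‖ = ‖∑ y, T (c, 0) x y * v y‖ := rfl
      _ ≤ ∑ y, ‖T (c, 0) x y * v y‖ := norm_sum_le _ _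
      _ ≤ ∑ y, |C x y| * ‖v‖ := by
        refine Finset.sum_le_sum fun y _ => ?_
        rw [norm_mul]
        have h1 := (hC x y c (subset_closure hc)).trans (le_abs_self _)
        have h2 := norm_le_pi_norm v y
        gcongr
      _ = (∑ y, |C x y|) * ‖v‖ := by rw [← Finset.sum_mul]
      _ ≤ M * ‖v‖ := by
        refine mul_le_mul_of_nonneg_right (le_trans ?_ hM) (norm_nonneg _)
        exact Finset.single_le_sum (f := fun x => ∑ y, |C x y|)
          (fun x _ => Finset.sum_nonneg fun y _ => abs_nonneg _) (Finset.mem_univ x)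
  obtain ⟨M, hM⟩ := hMex
  obtain ⟨Q, k, hQ, hk, hode, hQ0, hne⟩ := aux_main hR hUopen T hT v0 hv0 M hM
  have hode' : ∀ c ∈ U, ∀ z ∈ Metric.ball (0 : ℂ) R, ∀ i j,
        z * deriv (fun w => Q c w (i, j)) z =
          (A (c, z) * (Matrix.of fun i j => Q c z (i, j))
            - (Matrix.of fun i j => Q c z (i, j)) * a c) i j := by
    intro c hc z hz i j
    rw [hode c hc z hz (i, j)]
    exact auxOp_mulVec _ _ _ _ _
  have hQ0' : ∀ c ∈ U, (Matrix.of fun i j => Q c 0 (i, j)) = k c • (1 : Matrix (Fin N) (Fin N) ℂ) := by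
    intro c hc
    ext i j
    rw [Matrix.of_apply, hQ0 c hc]
    rfl
  refine ⟨fun c z => Matrix.of fun i j => Q c z (i, j), k, fun i j => hQ (i, j), hk, hode', hQ0', ?_⟩
  intro c hc hnr
  have hkc : k c ≠ 0 := by
    refine hne c hc fun m hm hdet => ?_
    obtain ⟨v, hv, hv0⟩ := Matrix.exists_mulVec_eq_zero_iff.2 hdet
    rw [Matrix.sub_mulVec, Matrix.smul_mulVec, Matrix.one_mulVec, sub_eq_zero] at hv0
    have hX : (Matrix.of fun i j => v (i, j)) = (0 : Matrix (Fin N) (Fin N) ℂ) := by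
      refine aux_sylvester (a c) _ m hm ?_ hnr
      ext i j
      have := congrFun hv0 (i, j)
      simp only [hTdef] at this
      rw [auxOp_mulVec, hA0] at this
      exact this
    apply hv
    funext ⟨i, j⟩
    exact congrFun (congrFun hX i) j
  refine ⟨hkc, ?_⟩
  have hQc : ∀ i j, DifferentiableOn ℂ (fun z => Q c z (i, j)) (ball 0 R) := fun i j =>
    (hQ (i, j)).comp (f := fun z : ℂ => (c, z)) (by fun_prop) (fun z hz => ⟨hc, hz⟩)
  have hAc : ∀ i j, DifferentiableOn ℂ (fun z => A (c, z) i j) (ball 0 R) := fun i j =>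
    (hA i j).comp (f := fun z : ℂ => (c, z)) (by fun_prop) (fun z hz => ⟨Set.mem_univ _, hz⟩)
  have hnv := aux_nonvanish (R := R) (f := fun z => (Matrix.of fun i j => Q c z (i, j)).det)
    (g := fun z => (A (c, z)).trace - (a c).trace) (aux_det_diff fun i j => hQc i j) ?_ ?_ ?_
  · intro z hz
    rw [Matrix.isUnit_iff_isUnit_det]
    exact (hnv z hz).isUnit
  · refine DifferentiableOn.fun_sub ?_ (differentiableOn_const _)
    simp only [Matrix.trace, Matrix.diag_apply]
    exact DifferentiableOn.fun_sum fun i _ => hAc i i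
  · intro z hz
    set X : Matrix (Fin N) (Fin N) ℂ := Matrix.of fun i j => Q c z (i, j) with hX
    have hj := aux_jacobi (fun z => Matrix.of fun i j => Q c z (i, j))
      (Matrix.of fun i j => deriv (fun w => Q c w (i, j)) z) z
      (fun i j => ((hQc i j).differentiableAt (isOpen_ball.mem_nhds hz)).hasDerivAt)
    rw [hj.deriv]
    have h1 : z • (Matrix.of fun i j => deriv (fun w => Q c w (i, j)) z) = A (c, z) * X - X * a c := by
      ext i j
      exact hode' c hc z hz i j
    rw [← smul_eq_mul, ← Matrix.trace_smul, ← Matrix.smul_mul, h1, sub_mul, Matrix.trace_sub,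
      mul_assoc, Matrix.mul_adjugate, Matrix.trace_mul_comm (X * a c), ← mul_assoc,
      Matrix.adjugate_mul]
    simp
    ring
  · show (Matrix.of fun i j => Q c 0 (i, j)).det ≠ 0
    rw [hQ0' c hc, Matrix.det_smul, Matrix.det_one, mul_one]
    exact pow_ne_zero _ hkc
end
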